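/- 𝒞_2(7,4,3) = 254; that is, the maximum cardinality of a cyclic code C ⊆ G_2(7,3) with minimum subspace distance at least 4 equals 254. -/

import Mathlib

open Module

/-- The cyclic shift `αV = {αv : v ∈ V}` of an `Fq`-subspace `V` of the extension field `F`
by a field element `α`. -/
def cyclicShift (Fq F : Type*) [Field Fq] [Field F] [Algebra Fq F]
    (α : F) (V : Submodule Fq F) : Submodule Fq F :=
  Submodule.map (LinearMap.mulLeft Fq α) V

/-- The subspace distance `d(U,W) = dim U + dim W − 2 dim (U ∩ W)`. -/
noncomputable def subspaceDist (Fq F : Type*) [Field Fq] [Field F] [Algebra Fq F]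
    (U W : Submodule Fq F) : ℕ :=
  finrank Fq U + finrank Fq W - 2 * finrank Fq ↥(U ⊓ W)

/-- `C` is a cyclic code in the Grassmannian `G_q(n,k)` (all members have dimension `k`,
and `C` is closed under cyclic shifts by nonzero field elements) with minimum subspace
distance at least `d`. -/
def IsCyclicCode (Fq F : Type*) [Field Fq] [Field F] [Algebra Fq F]
    (k d : ℕ) (C : Set (Submodule Fq F)) : Prop :=
  (∀ U ∈ C, finrank Fq U = k) ∧
  (∀ α : F, α ≠ 0 → ∀ U ∈ C, cyclicShift Fq F α U ∈ C) ∧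
  (∀ U ∈ C, ∀ W ∈ C, U ≠ W → d ≤ subspaceDist Fq F U W)

/-- The orbit `orb(V) = {αV : α ∈ F, α ≠ 0}` of a subspace `V`. -/
def orbitOf (Fq F : Type*) [Field Fq] [Field F] [Algebra Fq F]
    (V : Submodule Fq F) : Set (Submodule Fq F) :=
  {W | ∃ α : F, α ≠ 0 ∧ W = cyclicShift Fq F α V}

/-- The set of orbits of members of a code `C`. -/
def orbitsOf (Fq F : Type*) [Field Fq] [Field F] [Algebra Fq F]
    (C : Set (Submodule Fq F)) : Set (Set (Submodule Fq F)) :=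
  {O | ∃ V ∈ C, O = orbitOf Fq F V}

/-- The discrete logarithms to base `g`, packed seven bits each: block `n` holds the logarithm of
the element with coordinates the binary digits of `n`. -/
def logTable : ℕ :=
  503303598964455612746452337709073893966579758278161096143550713934713639264772211869980381528757591005896241120044067867836616769464179424350257294367796179758793383218588503166040635140982510427880193252580181704818945443102157276410608089680397520114585705893624561664

/-- The discrete logarithm of the element with code `n`. -/
def dlog (n : ℕ) : ℕ := (logTable >>> (7 * n)) % 128

/-- The discrete logarithm of the quotient `b / a` of the elements with codes `b` and `a`. -/
def dlogRatio (a b : ℕ) : ℕ := (dlog b + 127 - dlog a) % 127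

/-- The codes of the nonzero elements of the span of `1` and the elements with codes `x`, `y`. -/
def planePoints (x y : ℕ) : List ℕ := [y, 1, x, 1 ^^^ x, 1 ^^^ y, x ^^^ y, 1 ^^^ (x ^^^ y)]

/-- The pairs of distinct entries of a list. -/
def offDiagPairs (l : List ℕ) : List (ℕ × ℕ) := (l.product l).filter fun p => p.1 != p.2

/-- The logarithms of the quotients of distinct points of the plane generated by `1`, `x`, `y`. -/
def planeRatios (x y : ℕ) : List ℕ :=
  (offDiagPairs (planePoints x y)).map fun p => dlogRatio p.1 p.2

/-- Add the listed elements to the bit set `u`, failing when one of them is already present. -/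
def insertBits : List ℕ → ℕ → Option ℕ
  | [], u => some u
  | r :: rs, u => if u.testBit r then none else insertBits rs (u ||| 1 <<< r)

/-- Backtracking search: `refute k u` holds when the bit set `u` cannot be completed to all nonzero
logarithms by adjoining disjoint ratio sets of planes, because every branch fails within `k`
levels before everything is covered. -/
def refute : ℕ → ℕ → Bool
  | 0, _ => false
  | k + 1, u =>
    match (List.range 128).find? fun n => 2 ≤ n && !u.testBit (dlog n) with
    | none => false
    | some x => (List.range 64).all fun z => z = 0 || 2 * z == x || 2 * z == 1 ^^^ x ||
        match insertBits (planeRatios x (2 * z)) u with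
        | none => true
        | some v => refute k v

/-- Coordinates of `g * a` in terms of the coordinates of `a`, when `g ^ 7 = g + 1`. -/
def mulGen (n : ℕ) : ℕ := if n < 64 then 2 * n else 2 * n ^^^ 131

/-- The element whose coordinates in the basis `1, g, …, g ^ 6` are the binary digits of `n`. -/
def ofBits {F : Type*} [Field F] (g : F) (n : ℕ) : F :=
  ∑ k ∈ Finset.range 7, if n.testBit k then g ^ k else 0

theorem refute_three : refute 3 0 = true := by
  decide +kernel

theorem mulGen_lt : ∀ n < 128, mulGen n < 128 := by
  decide +kernel

theorem iterate_mulGen_lt (i : ℕ) : mulGen^[i] 1 < 128 := by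
  induction i with
  | zero => decide
  | succ i ih => rw [Function.iterate_succ_apply']; exact mulGen_lt _ ih

theorem iterate_mulGen_dlog : ∀ n < 128, n ≠ 0 → mulGen^[dlog n] 1 = n := by
  decide +kernel

theorem dlog_iterate_mulGen : ∀ i < 127, dlog (mulGen^[i] 1) = i := by
  decide +kernel

theorem dlog_lt : ∀ n < 128, dlog n < 127 := by
  decide +kernel

theorem testBit_mulGen_zero : ∀ n < 128, (mulGen n).testBit 0 = n.testBit 6 := by
  decide +kernel

theorem testBit_mulGen_one :
    ∀ n < 128, (mulGen n).testBit 1 = (n.testBit 0 ^^ n.testBit 6) := by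
  decide +kernel

theorem testBit_mulGen_add_two :
    ∀ n < 128, ∀ k < 5, (mulGen n).testBit (k + 2) = n.testBit (k + 1) := by
  decide +kernel

theorem xor_one_eq : ∀ n < 128, n % 2 = 1 → n ^^^ 1 = 2 * (n / 2) := by
  decide +kernel

section Coordinates

variable {F : Type*} [Field F] {g : F}

theorem gen_ne_zero (hg : g ^ 7 = g + 1) : g ≠ 0 := by
  rintro rfl
  simp at hg

theorem ofBits_zero : ofBits g 0 = 0 := by
  simp [ofBits]

theorem ofBits_one : ofBits g 1 = 1 := by
  simp [ofBits, Finset.sum_range_succ, Nat.testBit]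

variable [CharP F 2]

theorem ofBits_xor (m n : ℕ) : ofBits g (m ^^^ n) = ofBits g m + ofBits g n := by
  simp only [ofBits, ← Finset.sum_add_distrib]
  refine Finset.sum_congr rfl fun k _ => ?_
  rw [Nat.testBit_xor]
  cases m.testBit k <;> cases n.testBit k <;> simp [CharTwo.add_self_eq_zero]

theorem ofBits_mulGen (hg : g ^ 7 = g + 1) {n : ℕ} (hn : n < 128) :
    ofBits g (mulGen n) = g * ofBits g n := by
  have h0 := testBit_mulGen_zero n hn
  have h1 := testBit_mulGen_one n hn
  have h := testBit_mulGen_add_two n hn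
  have hx : (if (n.testBit 0 ^^ n.testBit 6) = true then g else 0) =
      (if n.testBit 0 then g else 0) + if n.testBit 6 then g else 0 := by
    cases n.testBit 0 <;> cases n.testBit 6 <;> simp [CharTwo.add_self_eq_zero]
  have h6 : (if n.testBit 6 then g ^ 7 else 0) =
      (if n.testBit 6 then g else 0) + if n.testBit 6 then 1 else 0 := by
    rw [hg]; split_ifs <;> simp
  simp only [ofBits, Finset.sum_range_succ, Finset.sum_range_zero, h0, h1, hx, h 0 (by norm_num),
    h 1 (by norm_num), h 2 (by norm_num), h 3 (by norm_num), h 4 (by norm_num), mul_add, mul_ite,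
    mul_zero, zero_add, ← pow_succ', pow_zero, pow_one, mul_one, h6]
  ring_nf

theorem ofBits_iterate_mulGen (hg : g ^ 7 = g + 1) (i : ℕ) :
    ofBits g (mulGen^[i] 1) = g ^ i := by
  induction i with
  | zero => simpa using ofBits_one
  | succ i ih =>
    rw [Function.iterate_succ_apply', ofBits_mulGen hg (iterate_mulGen_lt i), ih, pow_succ']

theorem ofBits_eq_pow (hg : g ^ 7 = g + 1) {n : ℕ} (hn : n < 128) (h0 : n ≠ 0) :
    ofBits g n = g ^ dlog n := by
  rw [← ofBits_iterate_mulGen hg, iterate_mulGen_dlog n hn h0]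

theorem gen_pow_card (hg : g ^ 7 = g + 1) : g ^ 127 = 1 := by
  rw [← ofBits_iterate_mulGen hg, show mulGen^[127] 1 = 1 by decide +kernel, ofBits_one]

theorem ofBits_ne_zero (hg : g ^ 7 = g + 1) {n : ℕ} (hn : n < 128) (h0 : n ≠ 0) :
    ofBits g n ≠ 0 := by
  rw [ofBits_eq_pow hg hn h0]
  exact pow_ne_zero _ (gen_ne_zero hg)

theorem ofBits_inj (hg : g ^ 7 = g + 1) {m n : ℕ} (hm : m < 128) (hn : n < 128)
    (h : ofBits g m = ofBits g n) : m = n := by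
  by_contra hne
  refine ofBits_ne_zero hg (Nat.xor_lt_two_pow (n := 7) hm hn) (n := m ^^^ n) ?_ ?_
  · rwa [Ne, Nat.xor_eq_zero_iff]
  · rw [ofBits_xor, h, CharTwo.add_self_eq_zero]

theorem ofBits_ne_one (hg : g ^ 7 = g + 1) {x : ℕ} (hx : x < 128) (hx1 : x ≠ 1) :
    ofBits g x ≠ 1 := by
  rw [← ofBits_one (g := g)]
  exact fun h => hx1 (ofBits_inj hg hx (by norm_num) h)

theorem gen_pow_inj (hg : g ^ 7 = g + 1) {r s : ℕ} (hr : r < 127) (hs : s < 127)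
    (h : g ^ r = g ^ s) : r = s := by
  rw [← ofBits_iterate_mulGen hg, ← ofBits_iterate_mulGen hg] at h
  rw [← dlog_iterate_mulGen r hr, ← dlog_iterate_mulGen s hs,
    ofBits_inj hg (iterate_mulGen_lt r) (iterate_mulGen_lt s) h]

theorem exists_ofBits_eq (hg : g ^ 7 = g + 1) (hF : Nat.card F = 128) (x : F) :
    ∃ n < 128, ofBits g n = x := by
  have : Finite F := Nat.finite_of_card_ne_zero (by omega)
  have : Fintype F := Fintype.ofFinite F
  have hinj : Function.Injective fun i : Fin 128 => ofBits g i := fun i j h =>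
    Fin.ext (ofBits_inj hg i.2 j.2 h)
  have hbij := (Fintype.bijective_iff_injective_and_card _).2
    ⟨hinj, by rw [Fintype.card_fin, ← Nat.card_eq_fintype_card, hF]⟩
  obtain ⟨i, hi⟩ := hbij.2 x
  exact ⟨i, i.2, hi⟩

theorem ofBits_div (hg : g ^ 7 = g + 1) {m n : ℕ} (hm : m < 128) (hn : n < 128) (hm0 : m ≠ 0)
    (hn0 : n ≠ 0) : ofBits g n / ofBits g m = g ^ dlogRatio m n := by
  have h1 := dlog_lt m hm
  rw [div_eq_iff (ofBits_ne_zero hg hm hm0), ofBits_eq_pow hg hn hn0, ofBits_eq_pow hg hm hm0,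
    dlogRatio, ← pow_eq_pow_mod _ (gen_pow_card hg), ← pow_add,
    show dlog n + 127 - dlog m + dlog m = dlog n + 127 by omega, pow_add, gen_pow_card hg, mul_one]

theorem dlogRatio_lt (m n : ℕ) : dlogRatio m n < 127 := Nat.mod_lt _ (by norm_num)

theorem planePoints_bounds {x y : ℕ} (hx : x < 128) (hy : y < 128) (hx0 : x ≠ 0) (hx1 : x ≠ 1)
    (hy0 : y ≠ 0) (hy1 : y ≠ 1) (hyx : y ≠ x) (hyx1 : y ≠ 1 ^^^ x) :
    ∀ n ∈ planePoints x y, n < 128 ∧ n ≠ 0 := by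
  have hxy : x ^^^ y < 128 := Nat.xor_lt_two_pow (n := 7) hx hy
  have h1 : ∀ {n}, n < 128 → 1 ^^^ n < 128 := fun h =>
    Nat.xor_lt_two_pow (n := 7) (by norm_num) h
  have h2 : 1 ≠ x ^^^ y := by
    intro h
    apply hyx1
    rw [h, Nat.xor_comm x y, Nat.xor_assoc, Nat.xor_self, Nat.xor_zero]
  simp only [planePoints, List.mem_cons, List.not_mem_nil, or_false, forall_eq_or_imp, forall_eq,
    Ne, Nat.xor_eq_zero_iff]
  exact ⟨⟨hy, hy0⟩, ⟨by norm_num, by norm_num⟩, ⟨hx, hx0⟩, ⟨h1 hx, Ne.symm hx1⟩,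
    ⟨h1 hy, Ne.symm hy1⟩, ⟨hxy, Ne.symm hyx⟩, h1 hxy, h2⟩

end Coordinates

section Planes

variable {F : Type*} [Field F] [Algebra (ZMod 2) F]

/-- The quotients of distinct nonzero elements of a subspace. -/
def subspaceRatios (U : Submodule (ZMod 2) F) : Set F :=
  {r | ∃ a ∈ U, ∃ b ∈ U, a ≠ 0 ∧ b ≠ 0 ∧ a ≠ b ∧ r = b / a}

/-- The quotients of distinct nonzero elements lying in a common codeword. -/
def codeRatios (C : Set (Submodule (ZMod 2) F)) : Set F :=
  {r | ∃ U ∈ C, r ∈ subspaceRatios U}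

theorem mem_cyclicShift {c x : F} (hc : c ≠ 0) {U : Submodule (ZMod 2) F} :
    x ∈ cyclicShift (ZMod 2) F c U ↔ x / c ∈ U := by
  simp only [cyclicShift, Submodule.mem_map, LinearMap.mulLeft_apply]
  constructor
  · rintro ⟨y, hy, rfl⟩
    rwa [mul_div_cancel_left₀ _ hc]
  · exact fun h => ⟨x / c, h, mul_div_cancel₀ _ hc⟩

theorem cyclicShift_cyclicShift {c d : F} (hc : c ≠ 0) (hd : d ≠ 0) (U : Submodule (ZMod 2) F) :
    cyclicShift (ZMod 2) F c (cyclicShift (ZMod 2) F d U) = cyclicShift (ZMod 2) F (c * d) U := by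
  ext x
  rw [mem_cyclicShift hc, mem_cyclicShift hd, mem_cyclicShift (mul_ne_zero hc hd), div_div]

theorem finrank_cyclicShift {c : F} (hc : c ≠ 0) (U : Submodule (ZMod 2) F) :
    finrank (ZMod 2) (cyclicShift (ZMod 2) F c U) = finrank (ZMod 2) U :=
  (Submodule.equivMapOfInjective _ (mul_right_injective₀ hc) U).finrank_eq.symm

theorem subspaceRatios_cyclicShift {c : F} (hc : c ≠ 0) (U : Submodule (ZMod 2) F) :
    subspaceRatios (cyclicShift (ZMod 2) F c U) = subspaceRatios U := by
  ext r
  constructor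
  · rintro ⟨a, ha, b, hb, ha0, hb0, hab, rfl⟩
    refine ⟨a / c, (mem_cyclicShift hc).1 ha, b / c, (mem_cyclicShift hc).1 hb,
      div_ne_zero ha0 hc, div_ne_zero hb0 hc, fun h => hab ?_, ?_⟩
    · exact (div_left_inj' hc).1 h
    · field_simp
  · rintro ⟨a, ha, b, hb, ha0, hb0, hab, rfl⟩
    refine ⟨c * a, Submodule.mem_map_of_mem ha, c * b, Submodule.mem_map_of_mem hb,
      mul_ne_zero hc ha0, mul_ne_zero hc hb0, fun h => hab (mul_left_cancel₀ hc h), ?_⟩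
    field_simp

theorem zmod_two_eq_zero_or_one (a : ZMod 2) : a = 0 ∨ a = 1 := by
  decide +revert

theorem mem_span_pair_zmod_two {x y u : F} :
    u ∈ Submodule.span (ZMod 2) {x, y} ↔ u = 0 ∨ u = x ∨ u = y ∨ u = x + y := by
  rw [Submodule.mem_span_pair]
  constructor
  · rintro ⟨a, b, rfl⟩
    rcases zmod_two_eq_zero_or_one a with rfl | rfl <;>
      rcases zmod_two_eq_zero_or_one b with rfl | rfl <;> simp
  · rintro (rfl | rfl | rfl | rfl)
    exacts [⟨0, 0, by simp⟩, ⟨1, 0, by simp⟩, ⟨0, 1, by simp⟩, ⟨1, 1, by simp⟩]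

theorem mem_span_triple_zmod_two {x y z u : F} :
    u ∈ Submodule.span (ZMod 2) {x, y, z} ↔
      u = 0 ∨ u = x ∨ u = y ∨ u = z ∨ u = x + y ∨ u = x + z ∨ u = y + z ∨ u = x + (y + z) := by
  rw [Submodule.mem_span_triple]
  constructor
  · rintro ⟨a, b, c, rfl⟩
    rcases zmod_two_eq_zero_or_one a with rfl | rfl <;>
      rcases zmod_two_eq_zero_or_one b with rfl | rfl <;>
      rcases zmod_two_eq_zero_or_one c with rfl | rfl <;> simp [add_assoc]
  · rintro (rfl | rfl | rfl | rfl | rfl | rfl | rfl | rfl)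
    exacts [⟨0, 0, 0, by simp⟩, ⟨1, 0, 0, by simp⟩, ⟨0, 1, 0, by simp⟩, ⟨0, 0, 1, by simp⟩,
      ⟨1, 1, 0, by simp⟩, ⟨1, 0, 1, by simp⟩, ⟨0, 1, 1, by simp⟩, ⟨1, 1, 1, by simp [add_assoc]⟩]

theorem mem_span_singleton_zmod_two {x u : F} :
    u ∈ Submodule.span (ZMod 2) {x} ↔ u = 0 ∨ u = x := by
  rw [Submodule.mem_span_singleton]
  constructor
  · rintro ⟨a, rfl⟩
    rcases zmod_two_eq_zero_or_one a with rfl | rfl <;> simp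
  · rintro (rfl | rfl)
    exacts [⟨0, by simp⟩, ⟨1, by simp⟩]

theorem exists_pair_of_two_le_finrank {V : Submodule (ZMod 2) F} (hV : 2 ≤ finrank (ZMod 2) V) :
    ∃ a ∈ V, ∃ b ∈ V, a ≠ 0 ∧ b ≠ 0 ∧ a ≠ b := by
  obtain ⟨a, ha, ha0⟩ := V.exists_mem_ne_zero_of_ne_bot (by rintro rfl; simp at hV)
  have hnot : ¬ V ≤ Submodule.span (ZMod 2) {a} := fun h => by
    have h1 := Submodule.finrank_mono h
    rw [finrank_span_singleton ha0] at h1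
    omega
  obtain ⟨b, hb, hba⟩ := SetLike.not_le_iff_exists.1 hnot
  rw [mem_span_singleton_zmod_two, not_or] at hba
  exact ⟨a, ha, b, hb, ha0, hba.1, Ne.symm hba.2⟩

theorem finrank_span_pair_le (x y : F) :
    finrank (ZMod 2) (Submodule.span (ZMod 2) {x, y}) ≤ 2 := by
  classical
  refine (finrank_span_le_card (R := ZMod 2) ({x, y} : Set F)).trans ?_
  simpa using Finset.card_le_two (a := x) (b := y)

variable [Finite F]

theorem two_le_finrank_span_pair {x y : F} (hx : x ≠ 0) (hy : y ≠ 0) (hxy : x ≠ y) :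
    2 ≤ finrank (ZMod 2) (Submodule.span (ZMod 2) {x, y}) := by
  have h : Submodule.span (ZMod 2) {x} < Submodule.span (ZMod 2) {x, y} := by
    refine SetLike.lt_iff_le_and_exists.2 ⟨Submodule.span_mono (by simp), y,
      Submodule.subset_span (by simp), fun h => ?_⟩
    rcases mem_span_singleton_zmod_two.1 h with h | h
    exacts [hy h, hxy h.symm]
  have := Submodule.finrank_lt_finrank_of_lt h
  rw [finrank_span_singleton hx] at this
  omega

theorem finrank_span_triple {x y z : F} (hx : x ≠ 0) (hy : y ≠ 0) (hxy : x ≠ y)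
    (hz : z ∉ Submodule.span (ZMod 2) {x, y}) :
    finrank (ZMod 2) (Submodule.span (ZMod 2) {x, y, z}) = 3 := by
  have h : Submodule.span (ZMod 2) {x, y} < Submodule.span (ZMod 2) {x, y, z} :=
    SetLike.lt_iff_le_and_exists.2 ⟨Submodule.span_mono (by simp [Set.insert_subset_iff]), z,
      Submodule.subset_span (by simp), hz⟩
  have h1 := Submodule.finrank_lt_finrank_of_lt h
  have h2 := two_le_finrank_span_pair hx hy hxy
  refine le_antisymm ?_ (by omega)
  classical
  refine (finrank_span_le_card (R := ZMod 2) ({x, y, z} : Set F)).trans ?_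
  simpa using Finset.card_le_three (a := x) (b := y) (c := z)

theorem span_triple_eq {x y z : F} {U : Submodule (ZMod 2) F} (hU : finrank (ZMod 2) U = 3)
    (hx : x ≠ 0) (hy : y ≠ 0) (hxy : x ≠ y) (hz : z ∉ Submodule.span (ZMod 2) {x, y})
    (hxU : x ∈ U) (hyU : y ∈ U) (hzU : z ∈ U) : Submodule.span (ZMod 2) {x, y, z} = U := by
  refine Submodule.eq_of_le_of_finrank_eq ?_ (by rw [finrank_span_triple hx hy hxy hz, hU])
  rw [Submodule.span_le]
  rintro u (rfl | rfl | rfl)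
  exacts [hxU, hyU, hzU]

theorem ncard_diff_zero {U : Submodule (ZMod 2) F} (hU : finrank (ZMod 2) U = 3) :
    ((U : Set F) \ {0}).ncard = 7 := by
  have h := Module.natCard_eq_pow_finrank (K := ZMod 2) (V := U)
  rw [hU, Nat.card_zmod] at h
  have h' : (U : Set F).ncard = 8 := h
  rw [Set.ncard_sdiff_singleton_of_mem (SetLike.mem_coe.2 U.zero_mem), h']

theorem eq_one_of_cyclicShift_eq (hF : Nat.card F = 128) {c : F} (hc : c ≠ 0)
    {U : Submodule (ZMod 2) F} (hU : finrank (ZMod 2) U = 3)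
    (h : cyclicShift (ZMod 2) F c U = U) : c = 1 := by
  classical
  have : Fintype F := Fintype.ofFinite F
  set S : Finset F := ((U : Set F) \ {0}).toFinset with hS
  have hcard : S.card = 7 := by rw [hS, ← Set.ncard_eq_toFinset_card', ncard_diff_zero hU]
  have himg : S.image (c * ·) = S := by
    refine Finset.eq_of_subset_of_card_le (fun x hx => ?_) ?_
    · obtain ⟨y, hy, rfl⟩ := Finset.mem_image.1 hx
      simp only [hS, Set.mem_toFinset, Set.mem_sdiff, SetLike.mem_coe,
        Set.mem_singleton_iff] at hy ⊢
      refine ⟨?_, mul_ne_zero hc hy.2⟩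
      rw [← h]
      exact Submodule.mem_map_of_mem hy.1
    · rw [Finset.card_image_of_injective _ (mul_right_injective₀ hc)]
  have hprod : ∏ x ∈ S, x ≠ 0 := Finset.prod_ne_zero_iff.2 fun x hx => by
    simp only [hS, Set.mem_toFinset, Set.mem_sdiff, Set.mem_singleton_iff] at hx
    exact hx.2
  have h7 : c ^ 7 = 1 := by
    have h2 : ∏ x ∈ S, x = c ^ 7 * ∏ x ∈ S, x := by
      conv_lhs => rw [← himg]
      rw [Finset.prod_image fun a _ b _ hab => mul_left_cancel₀ hc hab, Finset.prod_mul_distrib,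
        Finset.prod_const, hcard]
    exact (mul_eq_right₀ hprod).1 h2.symm
  have h127 : c ^ 127 = 1 := by
    have := FiniteField.pow_card_sub_one_eq_one c hc
    rwa [← Nat.card_eq_fintype_card, hF] at this
  have := pow_gcd_eq_one.2 ⟨h7, h127⟩
  simpa using this

end Planes

section Codes

variable {F : Type*} [Field F] [Algebra (ZMod 2) F] {C : Set (Submodule (ZMod 2) F)}
  {U W : Submodule (ZMod 2) F}

theorem IsCyclicCode.exists_mem_of_ratio (hC : IsCyclicCode (ZMod 2) F 3 4 C) {r : F}
    (hr : r ∈ codeRatios C) :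
    ∃ U ∈ C, 1 ∈ U ∧ r ∈ U := by
  obtain ⟨U, hU, a, ha, b, hb, ha0, hb0, hab, rfl⟩ := hr
  refine ⟨_, hC.2.1 a⁻¹ (inv_ne_zero ha0) U hU, ?_, ?_⟩
  · rw [← inv_mul_cancel₀ ha0]
    exact Submodule.mem_map_of_mem ha
  · rw [div_eq_inv_mul]
    exact Submodule.mem_map_of_mem hb

variable [Finite F]

theorem IsCyclicCode.eq_of_mem (hC : IsCyclicCode (ZMod 2) F 3 4 C) (hU : U ∈ C) (hW : W ∈ C)
    {a b : F} (ha : a ≠ 0) (hb : b ≠ 0) (hab : a ≠ b) (haU : a ∈ U) (hbU : b ∈ U) (haW : a ∈ W)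
    (hbW : b ∈ W) : U = W := by
  by_contra hne
  have h := hC.2.2 U hU W hW hne
  rw [subspaceDist, hC.1 U hU, hC.1 W hW] at h
  have hle : Submodule.span (ZMod 2) {a, b} ≤ U ⊓ W := by
    rw [Submodule.span_le]
    rintro u (rfl | rfl)
    exacts [⟨haU, haW⟩, ⟨hbU, hbW⟩]
  have h1 := Submodule.finrank_mono hle
  have h2 := two_le_finrank_span_pair ha hb hab
  omega

theorem IsCyclicCode.cyclicShift_eq (hC : IsCyclicCode (ZMod 2) F 3 4 C) (hU : U ∈ C)
    (hW : W ∈ C) {a b a' b' : F} (ha : a ≠ 0) (hb : b ≠ 0) (hab : a ≠ b) (haU : a ∈ U)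
    (hbU : b ∈ U) (ha' : a' ≠ 0) (haW : a' ∈ W) (hbW : b' ∈ W) (h : b / a = b' / a') :
    cyclicShift (ZMod 2) F (a' / a) U = W := by
  have hc : a' / a ≠ 0 := div_ne_zero ha' ha
  have hb' : b' = a' / a * b := by
    field_simp at h ⊢
    linear_combination -h
  subst hb'
  have e : a' = a' / a * a := (div_mul_cancel₀ _ ha).symm
  refine hC.eq_of_mem (hC.2.1 _ hc U hU) hW (a := a') (b := a' / a * b) ha' (mul_ne_zero hc hb) ?_
    ?_ (Submodule.mem_map_of_mem hbU) haW hbW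
  · intro h'
    exact hab (mul_left_cancel₀ hc (e.symm.trans h'))
  · rw [mem_cyclicShift hc]
    rwa [div_div_cancel₀ ha']

theorem IsCyclicCode.subspaceRatios_eq (hC : IsCyclicCode (ZMod 2) F 3 4 C) (hU : U ∈ C)
    (hW : W ∈ C) {r : F} (hrU : r ∈ subspaceRatios U) (hrW : r ∈ subspaceRatios W) :
    subspaceRatios U = subspaceRatios W := by
  obtain ⟨a, ha, b, hb, ha0, hb0, hab, rfl⟩ := hrU
  obtain ⟨a', ha', b', hb', ha0', hb0', hab', h⟩ := hrW
  rw [← hC.cyclicShift_eq hU hW ha0 hb0 hab ha hb ha0' ha' hb' h,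
    subspaceRatios_cyclicShift (div_ne_zero ha0' ha0)]

theorem IsCyclicCode.ratio_injective (hC : IsCyclicCode (ZMod 2) F 3 4 C)
    (hF : Nat.card F = 128) (hU : U ∈ C) {a b a' b' : F} (ha : a ≠ 0) (hb : b ≠ 0) (hab : a ≠ b)
    (haU : a ∈ U) (hbU : b ∈ U) (ha' : a' ≠ 0) (haU' : a' ∈ U) (hbU' : b' ∈ U)
    (h : b / a = b' / a') : a = a' ∧ b = b' := by
  have h1 := eq_one_of_cyclicShift_eq hF (div_ne_zero ha' ha) (hC.1 U hU)
    (hC.cyclicShift_eq hU hU ha hb hab haU hbU ha' haU' hbU' h)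
  rw [div_eq_one_iff_eq ha] at h1
  subst h1
  exact ⟨rfl, (div_left_inj' ha).1 h⟩

theorem IsCyclicCode.ncard_mul (hC : IsCyclicCode (ZMod 2) F 3 4 C) (hF : Nat.card F = 128) :
    C.ncard * 42 = 127 * (codeRatios C).ncard := by
  classical
  have : Fintype F := Fintype.ofFinite F
  have : Fintype (Submodule (ZMod 2) F) := Fintype.ofFinite _
  let P : Submodule (ZMod 2) F → Finset (F × F) := fun U => ((U : Set F) \ {0}).toFinset.offDiag
  have hP : ∀ U p, p ∈ P U ↔ (p.1 ∈ U ∧ p.1 ≠ 0) ∧ (p.2 ∈ U ∧ p.2 ≠ 0) ∧ p.1 ≠ p.2 := by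
    intro U p
    simp [P]
  have hcard : ∀ U ∈ C.toFinset, (P U).card = 42 := fun U hU => by
    rw [Finset.offDiag_card, ← Set.ncard_eq_toFinset_card',
      ncard_diff_zero (hC.1 U (Set.mem_toFinset.1 hU))]
  have hdisj : (C.toFinset : Set (Submodule (ZMod 2) F)).PairwiseDisjoint P := by
    intro U hU W hW hne
    refine Finset.disjoint_left.2 fun p hpU hpW => hne ?_
    rw [hP] at hpU hpW
    simp only [Set.coe_toFinset] at hU hW
    exact hC.eq_of_mem hU hW hpU.1.2 hpU.2.1.2 hpU.2.2 hpU.1.1 hpU.2.1.1 hpW.1.1 hpW.2.1.1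
  have hunion : C.toFinset.biUnion P =
      ((Finset.univ.erase (0 : F)) ×ˢ (codeRatios C).toFinset).image
      fun p => (p.1, p.1 * p.2) := by
    ext ⟨a, b⟩
    simp only [Finset.mem_biUnion, Set.mem_toFinset, hP, Finset.mem_image, Finset.mem_product,
      Finset.mem_erase, Finset.mem_univ, and_true, Prod.exists, Prod.mk.injEq]
    constructor
    · rintro ⟨U, hU, ⟨ha, ha0⟩, ⟨hb, hb0⟩, hab⟩
      exact ⟨a, b / a, ⟨ha0, U, hU, a, ha, b, hb, ha0, hb0, hab, rfl⟩, rfl, mul_div_cancel₀ _ ha0⟩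
    · rintro ⟨a, r, ⟨ha0, U, hU, u, hu, v, hv, hu0, hv0, huv, rfl⟩, rfl, rfl⟩
      have hc : a / u ≠ 0 := div_ne_zero ha0 hu0
      refine ⟨cyclicShift (ZMod 2) F (a / u) U, hC.2.1 _ hc U hU, ⟨?_, ha0⟩, ⟨?_, ?_⟩, ?_⟩
      · rw [mem_cyclicShift hc, div_div_cancel₀ ha0]
        exact hu
      · rw [← mul_div_assoc, mul_div_right_comm]
        exact Submodule.mem_map_of_mem hv
      · exact mul_ne_zero ha0 (div_ne_zero hv0 hu0)
      · intro h
        have h' := mul_left_cancel₀ ha0 ((mul_one a).trans h)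
        exact huv ((div_eq_one_iff_eq hu0).1 h'.symm).symm
  have hinj : Set.InjOn (fun p : F × F => (p.1, p.1 * p.2))
      ((Finset.univ.erase (0 : F)) ×ˢ (codeRatios C).toFinset : Finset (F × F)) := by
    rintro ⟨a, r⟩ h ⟨a', r'⟩ - heq
    simp only [Finset.coe_product, Set.mem_prod, Finset.mem_coe, Finset.mem_erase] at h
    simp only [Prod.mk.injEq] at heq
    obtain ⟨rfl, heq⟩ := heq
    rw [mul_left_cancel₀ h.1.1 heq]
  have h1 := Finset.card_biUnion hdisj
  rw [Finset.sum_congr rfl hcard, Finset.sum_const, hunion, Finset.card_image_of_injOn hinj,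
    Finset.card_product, Finset.card_erase_of_mem (Finset.mem_univ _), Finset.card_univ,
    ← Nat.card_eq_fintype_card, hF, ← Set.ncard_eq_toFinset_card', ← Set.ncard_eq_toFinset_card',
    smul_eq_mul] at h1
  exact h1.symm

end Codes

theorem insertBits_eq_some {l : List ℕ} {u : ℕ} (hl : l.Nodup)
    (hu : ∀ r ∈ l, u.testBit r = false) :
    ∃ v, insertBits l u = some v ∧ ∀ s, v.testBit s = true ↔ u.testBit s = true ∨ s ∈ l := by
  induction l generalizing u with
  | nil => exact ⟨u, rfl, by simp⟩
  | cons r l ih =>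
    rw [List.nodup_cons] at hl
    have hbit : ∀ s, (u ||| 1 <<< r).testBit s = true ↔ u.testBit s = true ∨ s = r := by
      intro s
      rw [Nat.testBit_or, Bool.or_eq_true, Nat.one_shiftLeft, Nat.testBit_two_pow,
        decide_eq_true_eq, eq_comm (a := r)]
    obtain ⟨v, hv, hv'⟩ := ih (u := u ||| 1 <<< r) hl.2 fun s hs => by
      rw [← Bool.not_eq_true, hbit, hu s (List.mem_cons_of_mem _ hs)]
      rintro (h | rfl)
      exacts [Bool.false_ne_true h, hl.1 hs]
    refine ⟨v, ?_, fun s => ?_⟩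
    · rw [insertBits, hu r List.mem_cons_self, ← hv]
      rfl
    · rw [hv', hbit, List.mem_cons, or_assoc]

theorem mem_offDiagPairs {l : List ℕ} {p : ℕ × ℕ} :
    p ∈ offDiagPairs l ↔ p.1 ∈ l ∧ p.2 ∈ l ∧ p.1 ≠ p.2 := by
  obtain ⟨a, b⟩ := p
  simp [offDiagPairs, and_assoc]

section Search

variable {F : Type*} [Field F] [Algebra (ZMod 2) F] [CharP F 2] {g : F}

theorem mem_span_iff_planePoints {x y : ℕ} {u : F} :
    u ∈ Submodule.span (ZMod 2) {1, ofBits g x, ofBits g y} ↔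
      u = 0 ∨ ∃ n ∈ planePoints x y, u = ofBits g n := by
  rw [mem_span_triple_zmod_two]
  simp only [planePoints, List.mem_cons, List.not_mem_nil, or_false, exists_eq_or_imp,
    exists_eq_left, ofBits_xor, ofBits_one]
  tauto

theorem mem_subspaceRatios_span_iff (hg : g ^ 7 = g + 1) {x y : ℕ}
    (h : ∀ n ∈ planePoints x y, n < 128 ∧ n ≠ 0) {r : F} :
    r ∈ subspaceRatios (Submodule.span (ZMod 2) {1, ofBits g x, ofBits g y}) ↔
      ∃ s ∈ planeRatios x y, r = g ^ s := by
  simp only [subspaceRatios, Set.mem_ofPred_eq, planeRatios, List.mem_map, mem_offDiagPairs,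
    mem_span_iff_planePoints]
  constructor
  · rintro ⟨_, rfl | ⟨m, hm, rfl⟩, _, rfl | ⟨n, hn, rfl⟩, hm0, hn0, hmn, rfl⟩
    · exact absurd rfl hm0
    · exact absurd rfl hm0
    · exact absurd rfl hn0
    · refine ⟨_, ⟨(m, n), ⟨hm, hn, fun h' => hmn (congrArg _ h')⟩, rfl⟩, ?_⟩
      rw [ofBits_div hg (h m hm).1 (h n hn).1 (h m hm).2 (h n hn).2]
  · rintro ⟨_, ⟨⟨m, n⟩, ⟨hm, hn, hmn⟩, rfl⟩, rfl⟩
    refine ⟨ofBits g m, Or.inr ⟨m, hm, rfl⟩, ofBits g n, Or.inr ⟨n, hn, rfl⟩,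
      ofBits_ne_zero hg (h m hm).1 (h m hm).2, ofBits_ne_zero hg (h n hn).1 (h n hn).2,
      fun h' => hmn (ofBits_inj hg (h m hm).1 (h n hn).1 h'), ?_⟩
    rw [ofBits_div hg (h m hm).1 (h n hn).1 (h m hm).2 (h n hn).2]

theorem ofBits_notMem_span (hg : g ^ 7 = g + 1) {x y : ℕ} (hx : x < 128) (hy : y < 128)
    (hy0 : y ≠ 0) (hy1 : y ≠ 1) (hyx : y ≠ x) (hyx1 : y ≠ 1 ^^^ x) :
    ofBits g y ∉ Submodule.span (ZMod 2) {1, ofBits g x} := by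
  have h1x : 1 ^^^ x < 128 := Nat.xor_lt_two_pow (n := 7) (by norm_num) hx
  rw [mem_span_pair_zmod_two, ← ofBits_zero (g := g), ← ofBits_one (g := g), ← ofBits_xor]
  rintro (h | h | h | h)
  exacts [hy0 (ofBits_inj hg hy (by norm_num) h), hy1 (ofBits_inj hg hy (by norm_num) h),
    hyx (ofBits_inj hg hy hx h), hyx1 (ofBits_inj hg hy h1x h)]

variable [Finite F]

theorem exists_even_code (hg : g ^ 7 = g + 1) (hF : Nat.card F = 128)
    {U : Submodule (ZMod 2) F} (hU : finrank (ZMod 2) U = 3) (h1 : 1 ∈ U) {x : F} :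
    ∃ z < 64, ofBits g (2 * z) ∈ U ∧
      ofBits g (2 * z) ∉ Submodule.span (ZMod 2) {1, x} := by
  have hnot : ¬ U ≤ Submodule.span (ZMod 2) {1, x} := fun h => by
    have h2 := Submodule.finrank_mono h
    have h3 := finrank_span_pair_le (1 : F) x
    omega
  obtain ⟨y, hyU, hy⟩ := SetLike.not_le_iff_exists.1 hnot
  obtain ⟨n, hn, rfl⟩ := exists_ofBits_eq hg hF y
  refine ⟨n / 2, by omega, ?_⟩
  rcases Nat.mod_two_eq_zero_or_one n with h | h
  · rw [show 2 * (n / 2) = n by omega]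
    exact ⟨hyU, hy⟩
  · rw [← xor_one_eq n hn h, ofBits_xor, ofBits_one]
    have h1' : (1 : F) ∈ Submodule.span (ZMod 2) {1, x} := Submodule.subset_span (by simp)
    exact ⟨U.add_mem hyU h1, fun h => hy ((Submodule.add_mem_iff_left _ h1').1 h)⟩

variable {C : Set (Submodule (ZMod 2) F)}

theorem nodup_planeRatios (hg : g ^ 7 = g + 1) (hF : Nat.card F = 128)
    (hC : IsCyclicCode (ZMod 2) F 3 4 C) {x y : ℕ}
    (h : ∀ n ∈ planePoints x y, n < 128 ∧ n ≠ 0)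
    (hU : Submodule.span (ZMod 2) {1, ofBits g x, ofBits g y} ∈ C) : (planeRatios x y).Nodup := by
  have hpts : (planePoints x y).Nodup := by
    classical
    have hsub : (Submodule.span (ZMod 2) {1, ofBits g x, ofBits g y} : Set F) \ {0} ⊆
        ((planePoints x y).toFinset.image (ofBits g) : Finset F) := by
      rintro u ⟨hu, hu0⟩
      rcases mem_span_iff_planePoints.1 hu with rfl | ⟨n, hn, rfl⟩
      · exact absurd rfl hu0
      · simpa using ⟨n, hn, rfl⟩
    have h7 := Set.ncard_le_ncard hsub (Finset.finite_toSet _)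
    rw [ncard_diff_zero (hC.1 _ hU), Set.ncard_coe_finset] at h7
    have h7' := h7.trans Finset.card_image_le
    rw [← Multiset.coe_nodup, ← Multiset.toFinset_card_eq_card_iff_nodup]
    exact le_antisymm (Multiset.toFinset_card_le _) h7'
  refine List.Nodup.map_on ?_ ((hpts.product hpts).filter _)
  rintro ⟨m, n⟩ hmn ⟨m', n'⟩ hmn' heq
  obtain ⟨hm, hn, hne⟩ := mem_offDiagPairs.1 hmn
  obtain ⟨hm', hn', -⟩ := mem_offDiagPairs.1 hmn'
  have hmem : ∀ k ∈ planePoints x y,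
      ofBits g k ∈ Submodule.span (ZMod 2) {1, ofBits g x, ofBits g y} := fun k hk =>
    mem_span_iff_planePoints.2 (Or.inr ⟨k, hk, rfl⟩)
  have hnz : ∀ k ∈ planePoints x y, ofBits g k ≠ 0 := fun k hk =>
    ofBits_ne_zero hg (h k hk).1 (h k hk).2
  have hinj := hC.ratio_injective hF hU (hnz m hm) (hnz n hn)
    (fun h' => hne (ofBits_inj hg (h m hm).1 (h n hn).1 h')) (hmem m hm) (hmem n hn)
    (hnz m' hm') (hmem m' hm') (hmem n' hn') (by
      rw [ofBits_div hg (h m hm).1 (h n hn).1 (h m hm).2 (h n hn).2,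
        ofBits_div hg (h m' hm').1 (h n' hn').1 (h m' hm').2 (h n' hn').2]
      exact congrArg _ heq)
  rw [ofBits_inj hg (h m hm).1 (h m' hm').1 hinj.1, ofBits_inj hg (h n hn).1 (h n' hn').1 hinj.2]

/-- The exponents recorded in `u` form a union of quotient sets of codewords. -/
def IsUnionOfRatios (g : F) (C : Set (Submodule (ZMod 2) F)) (u : ℕ) : Prop :=
  ∀ r, u.testBit r = true → ∃ U ∈ C, g ^ r ∈ subspaceRatios U ∧
    ∀ s < 127, g ^ s ∈ subspaceRatios U → u.testBit s = true

theorem refute_sound (hg : g ^ 7 = g + 1) (hF : Nat.card F = 128)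
    (hC : IsCyclicCode (ZMod 2) F 3 4 C)
    (hall : ∀ x : F, x ≠ 0 → x ≠ 1 → x ∈ codeRatios C) (k u : ℕ)
    (hu : IsUnionOfRatios g C u) : refute k u = false := by
  induction k generalizing u with
  | zero => rfl
  | succ k ih =>
    rw [← Bool.not_eq_true, refute]
    split
    · exact Bool.false_ne_true
    rename_i x hfind
    have hx : x < 128 := List.mem_range.1 (List.mem_of_find?_eq_some hfind)
    have hx' := List.find?_some hfind
    simp only [Bool.and_eq_true, decide_eq_true_eq, Bool.not_eq_true'] at hx'
    obtain ⟨hx2, hxu⟩ := hx'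
    have hx0 : ofBits g x ≠ 0 := ofBits_ne_zero hg hx (by omega)
    have hx1 : ofBits g x ≠ 1 := ofBits_ne_one hg hx (by omega)
    obtain ⟨U, hU, h1U, hxU⟩ := hC.exists_mem_of_ratio (hall _ hx0 hx1)
    obtain ⟨z, hz, hzU, hzs⟩ := exists_even_code hg hF (hC.1 U hU) h1U (x := ofBits g x)
    obtain rfl := span_triple_eq (hC.1 U hU) one_ne_zero hx0 hx1.symm hzs h1U hxU hzU
    have hz0 : z ≠ 0 := by
      rintro rfl
      exact hzs (by rw [mul_zero, ofBits_zero]; exact Submodule.zero_mem _)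
    have hzx : 2 * z ≠ x := fun h => hzs (by rw [h]; exact Submodule.subset_span (by simp))
    have hzx1 : 2 * z ≠ 1 ^^^ x := fun h => hzs (by
      rw [h, ofBits_xor, ofBits_one, mem_span_pair_zmod_two]
      simp)
    have hbd := planePoints_bounds hx (y := 2 * z) (by omega) (by omega) (by omega) (by omega)
      (by omega) hzx hzx1
    have hratio := @mem_subspaceRatios_span_iff F _ _ _ g hg x (2 * z) hbd
    have hdisj : ∀ r ∈ planeRatios x (2 * z), u.testBit r = false := by
      intro r hr
      rw [← Bool.not_eq_true]
      intro hru
      obtain ⟨W, hW, hrW, hWu⟩ := hu r hru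
      refine Bool.false_ne_true (hxu.symm.trans (hWu _ (dlog_lt x hx) ?_))
      rw [← hC.subspaceRatios_eq hU hW (hratio.2 ⟨r, hr, rfl⟩) hrW]
      exact ⟨1, h1U, ofBits g x, hxU, one_ne_zero, hx0, hx1.symm,
        by rw [div_one, ofBits_eq_pow hg hx (by omega)]⟩
    obtain ⟨v, hv, hv'⟩ := insertBits_eq_some (nodup_planeRatios hg hF hC hbd hU) hdisj
    have hvC : IsUnionOfRatios g C v := by
      intro r hr
      rcases (hv' r).1 hr with hr | hr
      · obtain ⟨W, hW, hrW, hWu⟩ := hu r hr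
        exact ⟨W, hW, hrW, fun s hs h => (hv' s).2 (Or.inl (hWu s hs h))⟩
      · refine ⟨_, hU, hratio.2 ⟨r, hr, rfl⟩, fun s hs h => (hv' s).2 (Or.inr ?_)⟩
        obtain ⟨t, ht, hst⟩ := hratio.1 h
        obtain ⟨p, -, rfl⟩ := List.mem_map.1 ht
        rwa [gen_pow_inj hg hs (dlogRatio_lt _ _) hst]
    intro hall'
    have h := List.all_eq_true.1 hall' z (List.mem_range.2 hz)
    simp only [hv, ih v hvC] at h
    simp [hz0, hzx, hzx1] at h

theorem IsCyclicCode.ncard_le (hg : g ^ 7 = g + 1) (hF : Nat.card F = 128)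
    (hC : IsCyclicCode (ZMod 2) F 3 4 C) : C.ncard ≤ 254 := by
  have hsub : codeRatios C ⊆ ({0, 1} : Set F)ᶜ := by
    rintro r ⟨U, -, a, -, b, -, ha0, hb0, hab, rfl⟩
    simp only [Set.mem_compl_iff, Set.mem_insert_iff, Set.mem_singleton_iff, not_or]
    exact ⟨div_ne_zero hb0 ha0, fun h => hab ((div_eq_one_iff_eq ha0).1 h).symm⟩
  have hne : codeRatios C ≠ ({0, 1} : Set F)ᶜ := by
    intro heq
    refine Bool.false_ne_true ((refute_sound hg hF hC (fun x hx0 hx1 => ?_) 3 0 ?_).symm.trans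
      refute_three)
    · rw [heq]
      simp [hx0, hx1]
    · intro r hr
      simp at hr
  have hlt := Set.ncard_lt_ncard (hsub.ssubset_of_ne hne)
  have h126 := Set.ncard_add_ncard_compl ({0, 1} : Set F)
  rw [Set.ncard_pair zero_ne_one, hF] at h126
  have := hC.ncard_mul hF
  omega

end Search

/-- The codes of the second and third generators of two planes whose orbits form an optimal code. -/
def basisCodes : Bool → ℕ × ℕ
  | false => (2, 12)
  | true => (8, 38)

theorem basisCodes_bounds (i : Bool) :
    ∀ n ∈ planePoints (basisCodes i).1 (basisCodes i).2, n < 128 ∧ n ≠ 0 := by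
  revert i
  decide +kernel

theorem eq_of_dlogRatio_eq (i j : Bool) :
    ∀ m ∈ planePoints (basisCodes i).1 (basisCodes i).2,
    ∀ n ∈ planePoints (basisCodes i).1 (basisCodes i).2, m ≠ n →
    ∀ m' ∈ planePoints (basisCodes j).1 (basisCodes j).2,
    ∀ n' ∈ planePoints (basisCodes j).1 (basisCodes j).2,
    dlogRatio m n = dlogRatio m' n' → i = j ∧ m = m' := by
  revert i j
  decide +kernel

section Construction

variable {F : Type*} [Field F] [Algebra (ZMod 2) F] [CharP F 2] {g : F}

/-- The two planes generating an optimal cyclic code. -/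
def basePlane (g : F) (i : Bool) : Submodule (ZMod 2) F :=
  Submodule.span (ZMod 2) {1, ofBits g (basisCodes i).1, ofBits g (basisCodes i).2}

/-- The union of the orbits of the two base planes. -/
def twoOrbitCode (g : F) : Set (Submodule (ZMod 2) F) :=
  (fun p : F × Bool => cyclicShift (ZMod 2) F p.1 (basePlane g p.2)) '' ({0}ᶜ ×ˢ Set.univ)

theorem exists_planePoint {i : Bool} {a : F} (ha : a ≠ 0) (h : a ∈ basePlane g i) :
    ∃ n ∈ planePoints (basisCodes i).1 (basisCodes i).2, a = ofBits g n :=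
  (mem_span_iff_planePoints.1 h).resolve_left ha

theorem basePlane_shift_inj (hg : g ^ 7 = g + 1) {i j : Bool} {c d a b : F} (hc : c ≠ 0)
    (hd : d ≠ 0) (ha : a ≠ 0) (hb : b ≠ 0) (hab : a ≠ b)
    (hac : a ∈ cyclicShift (ZMod 2) F c (basePlane g i))
    (hbc : b ∈ cyclicShift (ZMod 2) F c (basePlane g i))
    (had : a ∈ cyclicShift (ZMod 2) F d (basePlane g j))
    (hbd : b ∈ cyclicShift (ZMod 2) F d (basePlane g j)) : i = j ∧ c = d := by
  rw [mem_cyclicShift hc] at hac hbc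
  rw [mem_cyclicShift hd] at had hbd
  obtain ⟨m, hm, hm'⟩ := exists_planePoint (div_ne_zero ha hc) hac
  obtain ⟨n, hn, hn'⟩ := exists_planePoint (div_ne_zero hb hc) hbc
  obtain ⟨k, hk, hk'⟩ := exists_planePoint (div_ne_zero ha hd) had
  obtain ⟨l, hl, hl'⟩ := exists_planePoint (div_ne_zero hb hd) hbd
  have hi := basisCodes_bounds i
  have hj := basisCodes_bounds j
  have hratio : g ^ dlogRatio m n = g ^ dlogRatio k l := by
    rw [← ofBits_div hg (hi m hm).1 (hi n hn).1 (hi m hm).2 (hi n hn).2,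
      ← ofBits_div hg (hj k hk).1 (hj l hl).1 (hj k hk).2 (hj l hl).2, ← hm', ← hn', ← hk', ← hl',
      div_div_div_cancel_right₀ hc, div_div_div_cancel_right₀ hd]
  have hmn : m ≠ n := by
    rintro rfl
    exact hab ((div_left_inj' hc).1 (hm'.trans hn'.symm))
  obtain ⟨hij, rfl⟩ := eq_of_dlogRatio_eq i j m hm n hn hmn k hk l hl
    (gen_pow_inj hg (dlogRatio_lt _ _) (dlogRatio_lt _ _) hratio)
  refine ⟨hij, ?_⟩
  have h := hm'.trans hk'.symm
  rwa [div_eq_div_iff hc hd, mul_right_inj' ha, eq_comm] at h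

variable [Finite F]

theorem finrank_basePlane (hg : g ^ 7 = g + 1) (i : Bool) :
    finrank (ZMod 2) (basePlane g i) = 3 := by
  have h : (basisCodes i).1 < 128 ∧ (basisCodes i).1 ≠ 0 ∧ (basisCodes i).1 ≠ 1 ∧
      (basisCodes i).2 < 128 ∧ (basisCodes i).2 ≠ 0 ∧ (basisCodes i).2 ≠ 1 ∧
      (basisCodes i).2 ≠ (basisCodes i).1 ∧ (basisCodes i).2 ≠ 1 ^^^ (basisCodes i).1 := by
    revert i
    decide
  obtain ⟨hx, hx0, hx1, hy, hy0, hy1, hyx, hyx1⟩ := h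
  exact finrank_span_triple one_ne_zero (ofBits_ne_zero hg hx hx0) (ofBits_ne_one hg hx hx1).symm
    (ofBits_notMem_span hg hx hy hy0 hy1 hyx hyx1)

theorem isCyclicCode_twoOrbitCode (hg : g ^ 7 = g + 1) :
    IsCyclicCode (ZMod 2) F 3 4 (twoOrbitCode g) := by
  have hrank : ∀ U ∈ twoOrbitCode g, finrank (ZMod 2) U = 3 := by
    rintro _ ⟨⟨c, i⟩, ⟨hc, -⟩, rfl⟩
    exact (finrank_cyclicShift hc _).trans (finrank_basePlane hg i)
  refine ⟨hrank, ?_, ?_⟩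
  · rintro d hd _ ⟨⟨c, i⟩, ⟨hc, -⟩, rfl⟩
    exact ⟨⟨d * c, i⟩, ⟨mul_ne_zero hd hc, trivial⟩, (cyclicShift_cyclicShift hd hc _).symm⟩
  · intro U hU W hW hne
    rw [subspaceDist, hrank U hU, hrank W hW]
    suffices ¬ 2 ≤ finrank (ZMod 2) ↥(U ⊓ W) by omega
    intro h
    obtain ⟨a, ha, b, hb, ha0, hb0, hab⟩ := exists_pair_of_two_le_finrank h
    obtain ⟨⟨c, i⟩, ⟨hc, -⟩, rfl⟩ := hU
    obtain ⟨⟨d, j⟩, ⟨hd, -⟩, rfl⟩ := hW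
    obtain ⟨h1, h2⟩ := basePlane_shift_inj hg hc hd ha0 hb0 hab ha.1 hb.1 ha.2 hb.2
    exact hne (by simp only [show i = j from h1, show c = d from h2])

theorem ncard_twoOrbitCode (hg : g ^ 7 = g + 1) (hF : Nat.card F = 128) :
    (twoOrbitCode g).ncard = 254 := by
  have hinj : Set.InjOn (fun p : F × Bool => cyclicShift (ZMod 2) F p.1 (basePlane g p.2))
      ({0}ᶜ ×ˢ Set.univ) := by
    rintro ⟨c, i⟩ ⟨hc, -⟩ ⟨d, j⟩ ⟨hd, -⟩ h
    have h3 := (finrank_cyclicShift hc _).trans (finrank_basePlane hg i)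
    obtain ⟨a, ha, b, hb, ha0, hb0, hab⟩ :=
      exists_pair_of_two_le_finrank (le_of_le_of_eq (by norm_num) h3.symm)
    obtain ⟨rfl, rfl⟩ :=
      basePlane_shift_inj hg hc hd ha0 hb0 hab ha hb (h.le ha) (h.le hb)
    rfl
  have h127 := Set.ncard_add_ncard_compl ({0} : Set F)
  rw [Set.ncard_singleton, hF] at h127
  rw [twoOrbitCode, hinj.ncard_image, Set.ncard_prod, Set.ncard_univ,
    Nat.card_eq_fintype_card, Fintype.card_bool]
  omega

end Construction

section Generator

open Polynomial

theorem X_pow_seven_dvd :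
    (X ^ 7 + X + 1 : (ZMod 2)[X]) ∣ X ^ 2 ^ 7 - X := by
  have h2 : (2 : (ZMod 2)[X]) = 0 := CharTwo.two_eq_zero
  rw [← Ideal.mem_span_singleton, ← Ideal.Quotient.eq, map_pow]
  set r := Ideal.Quotient.mk (Ideal.span {(X ^ 7 + X + 1 : (ZMod 2)[X])}) X with hr
  have h2' : (2 : (ZMod 2)[X] ⧸ Ideal.span {(X ^ 7 + X + 1 : (ZMod 2)[X])}) = 0 := by
    rw [← map_ofNat (Ideal.Quotient.mk _), h2, map_zero]
  have h0 : r ^ 7 + r + 1 = 0 := by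
    rw [hr, ← map_pow, ← map_add, ← map_one (Ideal.Quotient.mk _), ← map_add,
      Ideal.Quotient.eq_zero_iff_mem]
    exact Ideal.mem_span_singleton_self _
  have h8 : r ^ 8 = r ^ 2 + r := by linear_combination r * h0 - (r ^ 2 + r) * h2'
  have h16 : r ^ 16 = r ^ 4 + r ^ 2 := by
    linear_combination (r ^ 8 + r ^ 2 + r) * h8 + r ^ 3 * h2'
  have h32 : r ^ 32 = r ^ 4 + r ^ 2 + r := by
    linear_combination (r ^ 16 + r ^ 4 + r ^ 2) * h16 + h8 + r ^ 6 * h2'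
  have h64 : r ^ 64 = r ^ 4 + r := by
    linear_combination (r ^ 32 + r ^ 4 + r ^ 2 + r) * h32 + h8 +
      (r ^ 6 + r ^ 5 + r ^ 3 + r ^ 2) * h2'
  have h128 : r ^ 128 = r := by
    linear_combination (r ^ 64 + r ^ 4 + r) * h64 + h8 + (r ^ 5 + r ^ 2) * h2'
  exact h128

theorem exists_pow_seven_eq {L : Type*} [Field L] [Algebra (ZMod 2) L] [CharP L 2]
    (hL : Nat.card L = 2 ^ 7) : ∃ g : L, g ^ 7 = g + 1 := by
  have h := (FiniteField.isSplittingField_of_nat_card_eq 2 7 hL).splits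
  have h0 : (X ^ 2 ^ 7 - X : (ZMod 2)[X]) ≠ 0 :=
    FiniteField.X_pow_card_pow_sub_X_ne_zero _ (by norm_num) (by norm_num)
  have hs := h.of_dvd (Polynomial.map_ne_zero h0) (Polynomial.map_dvd _ X_pow_seven_dvd)
  have hdeg : (X ^ 7 + X + 1 : (ZMod 2)[X]).degree = 7 := by compute_degree!
  have hdeg' : ((X ^ 7 + X + 1 : (ZMod 2)[X]).map (algebraMap (ZMod 2) L)).degree ≠ 0 := by
    rw [degree_map, hdeg]
    norm_num
  obtain ⟨g, hg⟩ := hs.exists_eval_eq_zero hdeg'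
  simp only [Polynomial.map_add, Polynomial.map_pow, map_X, Polynomial.map_one, eval_add,
    eval_pow, eval_X, eval_one] at hg
  refine ⟨g, ?_⟩
  linear_combination hg - (g + 1) * CharTwo.two_eq_zero (R := L)

end Generator

/-- 𝒞_2(7,4,3) = 254. -/
theorem C2_greatest :
    IsGreatest {m : ℕ | ∃ C : Set (Submodule (ZMod 2) (GaloisField 2 7)),
      IsCyclicCode (ZMod 2) (GaloisField 2 7) 3 4 C ∧ C.ncard = m} 254 := by
  have hF : Nat.card (GaloisField 2 7) = 128 := GaloisField.card 2 7 (by norm_num)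
  obtain ⟨g, hg⟩ := exists_pow_seven_eq hF
  refine ⟨⟨twoOrbitCode g, isCyclicCode_twoOrbitCode hg, ncard_twoOrbitCode hg hF⟩, ?_⟩
  rintro _ ⟨C, hC, rfl⟩
  exact hC.ncard_le hg hF
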